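/- arXiv:math/0110122 — 5 statements merged into one kernel-verified Lean document; each statement's English description precedes it below -/
import Mathlib

section
/- Let A be a divisible abelian group and let g : A → A be a group automorphism such that g(g(x)) = −x for all x ∈ A. Then the endomorphism g − id is surjective, i.e. for every y ∈ A there exists x ∈ A with g(x) − x = y. -/
/-- If `A` is a divisible abelian group and `g` is a group automorphism of `A`
with `g (g x) = -x` for all `x`, then `g - id` is surjective. -/
theorem stmt_0 {A : Type*} [AddCommGroup A]
    (hdiv : ∀ (a : A) (n : ℕ), 1 ≤ n → ∃ x : A, n • x = a)
    (g : A ≃+ A) (hg : ∀ x : A, g (g x) = -x) :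
    ∀ y : A, ∃ x : A, g x - x = y := by
  intro y
  obtain ⟨z, rfl⟩ := hdiv y 2 one_le_two
  refine ⟨-(g z + z), ?_⟩
  rw [map_neg, map_add, hg]
  abel
end

section
/- Let A be a divisible abelian group, g : A → A a group automorphism, and a ∈ A. Define σ : A → A by σ(x) = g(x) + a. If σ(σ(x)) = −x for all x ∈ A, then σ has a fixed point, i.e. there exists x₀ ∈ A with g(x₀) + a = x₀. In particular, a fixed-point-free affine transformation σ(x) = g(x) + a of a divisible abelian group cannot satisfy σ∘σ = −id. -/
/-- If `A` is a divisible abelian group, `g` a group automorphism of `A`, `a ∈ A`,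
and the affine map `σ x = g x + a` satisfies `σ (σ x) = -x` for all `x`, then `σ`
has a fixed point. -/
theorem stmt_1 {A : Type*} [AddCommGroup A]
    (hdiv : ∀ (a : A) (n : ℕ), 1 ≤ n → ∃ x : A, n • x = a)
    (g : A ≃+ A) (a : A) (σ : A → A) (hσ : ∀ x : A, σ x = g x + a)
    (h : ∀ x : A, σ (σ x) = -x) :
    ∃ x₀ : A, g x₀ + a = x₀ := by
  obtain ⟨y, hy⟩ := hdiv a 2 one_le_two
  have hga : g a + a = 0 := by simpa [hσ] using h 0
  have hgg : g (g y) = -y := by simpa [hσ, add_assoc, hga] using h y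
  refine ⟨y + g y, ?_⟩
  rw [map_add, hgg, ← hy]
  abel
end

section
/- Let Λ₁, Λ₂ ⊆ ℂ be ℤ-lattices, set D₁ = ℂ/Λ₁ and D₂ = ℂ/Λ₂, and let a ∈ D₁, b ∈ D₂ be nonzero elements with 2a = 0, 2b = 0. Define σ₁(x₁,x₂) = (−x₁, x₂ + b) and σ₂(x₁,x₂) = (x₁ + a, −x₂) on D₁ × D₂. Then the fixed point set F of σ₁∘σ₂ has exactly 16 elements, σ₁ maps F to itself and acts on F without fixed points, and the action of the group generated by σ₁ and σ₂ on F has exactly 8 orbits. -/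
theorem exists_int_basis_of_lattice (Λ : AddSubgroup ℂ) (hdisc : DiscreteTopology Λ)
    (hspan : Submodule.span ℝ (Λ : Set ℂ) = ⊤) :
    ∃ u v : ℂ, (∀ w, w ∈ Λ ↔ ∃ m n : ℤ, w = m * u + n * v) ∧
      ∀ m n : ℤ, (m * u + n * v : ℂ) = 0 → m = 0 ∧ n = 0 := by
  let L : Submodule ℤ ℂ := AddSubgroup.toIntSubmodule Λ
  have hL : DiscreteTopology L := hdisc
  have : IsZLattice ℝ L := ⟨hspan⟩
  have hfree : Module.Free ℤ L := ZLattice.module_free ℝ L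
  have hfin : Module.Finite ℤ L := ZLattice.module_finite ℝ L
  have hrank : Module.finrank ℤ L = 2 := by
    rw [ZLattice.rank ℝ L, Complex.finrank_real_complex]
  let e := Module.finBasisOfFinrankEq ℤ L hrank
  refine ⟨e 0, e 1, fun w => ⟨fun hw => ?_, ?_⟩, fun m n h => ?_⟩
  · have h := congrArg Subtype.val (e.sum_repr ⟨w, hw⟩)
    refine ⟨e.repr ⟨w, hw⟩ 0, e.repr ⟨w, hw⟩ 1, ?_⟩
    rw [Fin.sum_univ_two] at h
    simpa only [Submodule.coe_add, Submodule.coe_smul, zsmul_eq_mul] using h.symm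
  · rintro ⟨m, n, rfl⟩
    have h : ((m • e 0 + n • e 1 : L) : ℂ) ∈ Λ := (m • e 0 + n • e 1 : L).2
    simpa using h
  · have h0 : m • e 0 + n • e 1 = 0 := by
      apply Subtype.ext
      simpa using h
    have := Fintype.linearIndependent_iff.1 e.linearIndependent ![m, n]
      (by simpa [Fin.sum_univ_two] using h0)
    exact ⟨this 0, this 1⟩

theorem ncard_add_self_eq (Λ : AddSubgroup ℂ) (hdisc : DiscreteTopology Λ)
    (hspan : Submodule.span ℝ (Λ : Set ℂ) = ⊤) (c : ℂ ⧸ Λ) :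
    {x : ℂ ⧸ Λ | x + x = c}.ncard = 4 := by
  obtain ⟨u, v, hmem, hind⟩ := exists_int_basis_of_lattice Λ hdisc hspan
  obtain ⟨z, rfl⟩ := QuotientAddGroup.mk_surjective c
  let f : Fin 2 × Fin 2 → ℂ ⧸ Λ := fun p =>
    QuotientAddGroup.mk ((z + (p.1.val : ℂ) * u + (p.2.val : ℂ) * v) / 2)
  have hf : Function.Injective f := by
    rintro ⟨i, j⟩ ⟨k, l⟩ h
    obtain ⟨m, n, hmn⟩ := (hmem _).1 (QuotientAddGroup.eq.1 h)
    have := hind (k.val - i.val - 2 * m) (l.val - j.val - 2 * n) (by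
      push_cast
      linear_combination 2 * hmn)
    ext <;> simp only <;> omega
  have hrange : {x : ℂ ⧸ Λ | x + x = QuotientAddGroup.mk z} = Set.range f := by
    ext x
    constructor
    · intro hx
      obtain ⟨w, rfl⟩ := QuotientAddGroup.mk_surjective x
      have hx' : (QuotientAddGroup.mk z : ℂ ⧸ Λ) = QuotientAddGroup.mk (w + w) := hx.symm
      obtain ⟨m, n, hmn⟩ := (hmem _).1 (QuotientAddGroup.eq.1 hx')
      refine ⟨(⟨(m % 2).toNat, by omega⟩, ⟨(n % 2).toNat, by omega⟩), ?_⟩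
      refine QuotientAddGroup.eq.2 ((hmem _).2 ⟨m / 2, n / 2, ?_⟩)
      have hcast (k : ℤ) : (((k % 2).toNat : ℕ) : ℂ) = k - 2 * ((k / 2 : ℤ) : ℂ) := by
        have : (((k % 2).toNat : ℕ) : ℤ) = k - 2 * (k / 2) := by omega
        exact_mod_cast congrArg (Int.cast : ℤ → ℂ) this
      simp only [hcast]
      linear_combination hmn / 2
    · rintro ⟨⟨i, j⟩, rfl⟩
      refine (QuotientAddGroup.eq.2 ((hmem _).2 ⟨i.val, j.val, ?_⟩)).symm
      push_cast
      ring
  rw [hrange, ← Set.image_univ, Set.ncard_image_of_injective _ hf, Set.ncard_univ]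
  simp

theorem ncard_eq_two_mul_ncard_image {α β : Type*} {F : Set α} (hF : F.Finite) (f : α → β)
    (g : α → α) (hg : ∀ x ∈ F, g x ≠ x)
    (hfib : ∀ x ∈ F, ∀ y, y ∈ F ∧ f y = f x ↔ y = x ∨ y = g x) :
    F.ncard = 2 * (f '' F).ncard := by
  classical
  obtain ⟨s, rfl⟩ := hF.exists_finset_coe
  rw [← Finset.coe_image, Set.ncard_coe_finset, Set.ncard_coe_finset,
    Finset.card_eq_sum_card_image f s, Finset.sum_const_nat (m := 2), mul_comm]
  intro b hb
  obtain ⟨x, hx, rfl⟩ := Finset.mem_image.1 hb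
  have : s.filter (fun y => f y = f x) = {x, g x} := by
    ext y
    simpa using hfib x hx y
  rw [this, Finset.card_pair (hg x hx).symm]

theorem orbit_closure_pair_eq {α : Type*} {F : Set α} {s t : Equiv.Perm α}
    (hs : ∀ x ∈ F, s x ∈ F) (hss : ∀ x ∈ F, s (s x) = x) (hst : ∀ x ∈ F, t x = s x)
    {x : α} (hx : x ∈ F) :
    MulAction.orbit (Subgroup.closure {s, t}) x = {x, s x} := by
  have key : ∀ g ∈ Subgroup.closure {s, t}, (∀ y ∈ F, g y = y) ∨ ∀ y ∈ F, g y = s y := by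
    intro g hg
    induction hg using Subgroup.closure_induction with
    | mem g hg =>
      rcases hg with rfl | rfl
      · exact Or.inr fun _ _ => rfl
      · exact Or.inr hst
    | one => exact Or.inl fun _ _ => rfl
    | mul g h _ _ hg hh =>
      simp only [Equiv.Perm.mul_apply]
      rcases hg with hg | hg <;> rcases hh with hh | hh
      · exact Or.inl fun y hy => by rw [hh y hy, hg y hy]
      · exact Or.inr fun y hy => by rw [hh y hy, hg _ (hs y hy)]
      · exact Or.inr fun y hy => by rw [hh y hy, hg y hy]
      · exact Or.inl fun y hy => by rw [hh y hy, hg _ (hs y hy), hss y hy]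
    | inv g _ hg =>
      simp only [Equiv.Perm.inv_eq_iff_eq]
      rcases hg with hg | hg
      · exact Or.inl fun y hy => (hg y hy).symm
      · exact Or.inr fun y hy => by rw [hg _ (hs y hy), hss y hy]
  ext y
  constructor
  · rintro ⟨⟨g, hg⟩, rfl⟩
    exact (key g hg).imp (fun h => h x hx) (fun h => h x hx)
  · rintro (rfl | rfl)
    · exact MulAction.mem_orbit_self _
    · exact ⟨⟨s, Subgroup.subset_closure (Or.inl rfl)⟩, rfl⟩

/-- Example 1: the fixed point set `F` of `σ₁ ∘ σ₂` on the product of two complex tori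
has exactly 16 elements, `σ₁` maps `F` to itself without fixed points, and the group
generated by `σ₁` and `σ₂` has exactly 8 orbits on `F`. -/
theorem stmt_6 (Λ₁ Λ₂ : AddSubgroup ℂ)
    (hdisc₁ : DiscreteTopology Λ₁) (hspan₁ : Submodule.span ℝ (Λ₁ : Set ℂ) = ⊤)
    (hdisc₂ : DiscreteTopology Λ₂) (hspan₂ : Submodule.span ℝ (Λ₂ : Set ℂ) = ⊤)
    (a : ℂ ⧸ Λ₁) (b : ℂ ⧸ Λ₂) (ha2 : a + a = 0) (ha : a ≠ 0) (hb2 : b + b = 0) (hb : b ≠ 0)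
    (σ₁ σ₂ : Equiv.Perm ((ℂ ⧸ Λ₁) × (ℂ ⧸ Λ₂)))
    (hσ₁ : ∀ p, σ₁ p = (-p.1, p.2 + b))
    (hσ₂ : ∀ p, σ₂ p = (p.1 + a, -p.2))
    (F : Set ((ℂ ⧸ Λ₁) × (ℂ ⧸ Λ₂))) (hF : F = {p | σ₁ (σ₂ p) = p})
    (G : Subgroup (Equiv.Perm ((ℂ ⧸ Λ₁) × (ℂ ⧸ Λ₂)))) (hG : G = Subgroup.closure {σ₁, σ₂}) :
    F.Finite ∧ F.ncard = 16 ∧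
    (∀ p ∈ F, σ₁ p ∈ F) ∧ (∀ p ∈ F, σ₁ p ≠ p) ∧
    {S : Set ((ℂ ⧸ Λ₁) × (ℂ ⧸ Λ₂)) | ∃ p ∈ F, S = MulAction.orbit G p}.ncard = 8 := by
  have hna : -a = a := neg_eq_of_add_eq_zero_left ha2
  have hnb : -b = b := neg_eq_of_add_eq_zero_left hb2
  have hmem (p) : p ∈ F ↔ p.1 + p.1 = a ∧ p.2 + p.2 = b := by
    rw [hF, Set.mem_ofPred_eq, hσ₂, hσ₁, Prod.ext_iff]
    refine and_congr ?_ ?_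
    · rw [neg_eq_iff_add_eq_zero, add_right_comm, add_eq_zero_iff_eq_neg, hna]
    · rw [neg_add_eq_iff_eq_add, eq_comm]
  have hprod : F = {x : ℂ ⧸ Λ₁ | x + x = a} ×ˢ {x : ℂ ⧸ Λ₂ | x + x = b} := by
    ext p
    exact hmem p
  have hcard : F.ncard = 16 := by
    rw [hprod, Set.ncard_prod, ncard_add_self_eq Λ₁ hdisc₁ hspan₁,
      ncard_add_self_eq Λ₂ hdisc₂ hspan₂]
  have hfin : F.Finite := Set.finite_of_ncard_ne_zero (by omega)
  have hmaps : ∀ p ∈ F, σ₁ p ∈ F := by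
    intro p hp
    obtain ⟨h1, h2⟩ := (hmem p).1 hp
    rw [hmem, hσ₁]
    exact ⟨by rw [← neg_add, h1, hna], by rw [add_add_add_comm, h2, hb2, add_zero]⟩
  have hne : ∀ p ∈ F, σ₁ p ≠ p := by
    intro p _ h
    rw [hσ₁] at h
    exact hb (add_eq_left.1 (congrArg Prod.snd h))
  have hinv : ∀ p ∈ F, σ₁ (σ₁ p) = p := by
    intro p _
    simp [hσ₁, add_assoc, hb2]
  have heq : ∀ p ∈ F, σ₂ p = σ₁ p := by
    intro p hp
    obtain ⟨h1, h2⟩ := (hmem p).1 hp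
    rw [hσ₁, hσ₂]
    refine Prod.ext ?_ ?_
    · simp only
      rw [← hna, ← h1]
      abel
    · simp only
      rw [← hnb, ← h2]
      abel
  refine ⟨hfin, hcard, hmaps, hne, ?_⟩
  have horb : ∀ p ∈ F, MulAction.orbit G p = {p, σ₁ p} := by
    subst hG
    exact fun p hp => orbit_closure_pair_eq hmaps hinv heq hp
  have himage : {S : Set ((ℂ ⧸ Λ₁) × (ℂ ⧸ Λ₂)) | ∃ p ∈ F, S = MulAction.orbit G p} =
      (fun p => MulAction.orbit G p) '' F := by
    ext S
    simp only [Set.mem_ofPred_eq, Set.mem_image, eq_comm]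
  have hcount := ncard_eq_two_mul_ncard_image hfin (fun p => MulAction.orbit G p) σ₁ hne (by
    intro p hp q
    rw [MulAction.orbit_eq_iff, horb p hp]
    refine ⟨And.right, fun h => ⟨?_, h⟩⟩
    rcases h with rfl | rfl
    exacts [hp, hmaps p hp])
  rw [himage]
  omega
end

section
/- Let Λ₁, Λ₂ ⊆ ℂ be ℤ-lattices, set D₁ = ℂ/Λ₁ and D₂ = ℂ/Λ₂, let a₁, a₂ ∈ D₁ satisfy 2a₁ = 2a₂ = 0 with a₁, a₂, a₁+a₂ all nonzero, and let b₁, b₃ ∈ D₂ satisfy 2b₁ = 2b₃ = 0 with b₁, b₃, b₁+b₃ all nonzero. Define τ₁(x₁,x₂) = (x₁ + a₁, x₂ + b₁), τ₂(x₁,x₂) = (x₁ + a₂, −x₂), τ₃(x₁,x₂) = (−x₁, x₂ + b₃) on D₁ × D₂. Then the fixed point set F of τ₂∘τ₃ has exactly 16 elements, the group G generated by τ₁, τ₂, τ₃ (isomorphic to ℤ/2 × ℤ/2 × ℤ/2) maps F to itself, and the action of G on F has exactly 4 orbits. -/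
/-- Any quotient group of `ℂ` is divisible by two. -/
theorem exists_add_self_eq_quotient (Λ : AddSubgroup ℂ) (a : ℂ ⧸ Λ) : ∃ x, x + x = a := by
  induction a using QuotientAddGroup.induction_on with
  | H z => exact ⟨((z / 2 : ℂ) : ℂ ⧸ Λ), by rw [← QuotientAddGroup.mk_add, add_halves]⟩

/-- A complex torus has at most four two-torsion points. -/
theorem ncard_two_torsion_le (Λ : AddSubgroup ℂ) (hdisc : DiscreteTopology Λ)
    (hspan : Submodule.span ℝ (Λ : Set ℂ) = ⊤) :
    {t : ℂ ⧸ Λ | t + t = 0}.Finite ∧ {t : ℂ ⧸ Λ | t + t = 0}.ncard ≤ 4 := by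
  let L : Submodule ℤ ℂ := AddSubgroup.toIntSubmodule Λ
  have : DiscreteTopology L := hdisc
  have : IsZLattice ℝ L := ⟨hspan⟩
  have hrank : Module.finrank ℤ L = 2 := by
    rw [ZLattice.rank ℝ L, Complex.finrank_real_complex]
  have : Module.Free ℤ L := ZLattice.module_free ℝ L
  have : Module.Finite ℤ L := ZLattice.module_finite ℝ L
  let b := Module.finBasisOfFinrankEq ℤ L hrank
  let f : Fin 2 × Fin 2 → ℂ ⧸ Λ := fun p =>
    ((((p.1 : ℕ) * (b 0 : ℂ) + (p.2 : ℕ) * (b 1 : ℂ)) / 2 : ℂ) : ℂ ⧸ Λ)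
  have hsub : {t : ℂ ⧸ Λ | t + t = 0} ⊆ Set.range f := by
    intro t ht
    induction t using QuotientAddGroup.induction_on with
    | H z =>
      have hz : z + z ∈ Λ := by
        rw [← QuotientAddGroup.eq_zero_iff]
        exact ht
      let l : L := ⟨z + z, hz⟩
      have hl : z + z = (b.repr l 0 : ℂ) * (b 0 : ℂ) + (b.repr l 1 : ℂ) * (b 1 : ℂ) := by
        have h := congrArg (Subtype.val) (b.sum_repr l)
        simp only [Fin.sum_univ_two, Submodule.coe_add, Submodule.coe_smul, zsmul_eq_mul] at h
        exact h.symm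
      have hdig : ∀ m : ℤ, ∃ (i : Fin 2) (k : ℤ), m = 2 * k + (i : ℕ) := by
        intro m
        rcases Int.even_or_odd' m with ⟨k, h | h⟩
        · exact ⟨0, k, by simpa using h⟩
        · exact ⟨1, k, by simpa using h⟩
      obtain ⟨i, k, hi⟩ := hdig (b.repr l 0)
      obtain ⟨j, n, hj⟩ := hdig (b.repr l 1)
      refine ⟨(i, j), ?_⟩
      refine QuotientAddGroup.eq.2 ?_
      have hmem : k • (b 0 : ℂ) + n • (b 1 : ℂ) ∈ Λ :=
        Λ.add_mem (Λ.zsmul_mem (b 0).2 k) (Λ.zsmul_mem (b 1).2 n)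
      convert hmem using 1
      rw [hi, hj] at hl
      push_cast at hl
      simp only [zsmul_eq_mul]
      linear_combination hl / 2
  refine ⟨(Set.finite_range f).subset hsub, (Set.ncard_le_ncard hsub (Set.finite_range f)).trans ?_⟩
  rw [← Set.image_univ]
  refine (Set.ncard_image_le Set.finite_univ).trans ?_
  simp [Set.ncard_univ]

section TwoTorsion

variable {D : Type*} [AddCommGroup D] {a b : D}

/-- Two independent two-torsion elements span four elements. -/
theorem ncard_span_two_torsion (x : D) (hb2 : b + b = 0)
    (ha : a ≠ 0) (hb : b ≠ 0) (hab : a + b ≠ 0) :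
    ({x, x + a, x + b, x + (a + b)} : Set D).ncard = 4 := by
  have hne : a ≠ b := fun h => hab (by rw [h, hb2])
  rw [Set.ncard_insert_of_notMem, Set.ncard_insert_of_notMem, Set.ncard_pair]
  · simp [ha]
  · simp [hne, hb]
  · simp [ha, hb, hab]

theorem even_of_zsmul_add_zsmul_eq_zero (ha2 : a + a = 0) (hb2 : b + b = 0)
    (ha : a ≠ 0) (hb : b ≠ 0) (hab : a + b ≠ 0) {m n : ℤ} (h : m • a + n • b = 0) :
    Even m ∧ Even n := by
  have ha' : (2 : ℤ) • a = 0 := by rw [two_zsmul, ha2]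
  have hb' : (2 : ℤ) • b = 0 := by rw [two_zsmul, hb2]
  rcases Int.even_or_odd' m with ⟨k, rfl | rfl⟩ <;> rcases Int.even_or_odd' n with ⟨l, rfl | rfl⟩ <;>
    simp_all [add_zsmul, mul_comm (2 : ℤ), mul_zsmul]

theorem add_add_self_of_two_torsion {x : D} (ha2 : a + a = 0) : x + a + (x + a) = x + x := by
  rw [add_add_add_comm, ha2, add_zero]

theorem even_zsmul_eq_zero (ha2 : a + a = 0) {m : ℤ} (hm : Even m) : m • a = 0 := by
  obtain ⟨k, rfl⟩ := hm
  rw [add_zsmul, ← zsmul_add, ha2, zsmul_zero]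

end TwoTorsion

/-- The halves of `c` form a coset of the two-torsion of a complex torus. -/
theorem setOf_add_self_eq (Λ : AddSubgroup ℂ) (hdisc : DiscreteTopology Λ)
    (hspan : Submodule.span ℝ (Λ : Set ℂ) = ⊤) {a b c x : ℂ ⧸ Λ}
    (ha2 : a + a = 0) (hb2 : b + b = 0) (ha : a ≠ 0) (hb : b ≠ 0) (hab : a + b ≠ 0)
    (hx : x + x = c) :
    {y | y + y = c} = {x, x + a, x + b, x + (a + b)} := by
  obtain ⟨hfin, hle⟩ := ncard_two_torsion_le Λ hdisc hspan
  have hT : {0, 0 + a, 0 + b, 0 + (a + b)} = {t : ℂ ⧸ Λ | t + t = 0} := by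
    refine Set.eq_of_subset_of_ncard_le ?_ ?_ hfin
    · rintro t (rfl | rfl | rfl | rfl)
      · simp
      · simpa using ha2
      · simpa using hb2
      · simp [add_add_add_comm, ha2, hb2]
    · rwa [ncard_span_two_torsion 0 hb2 ha hb hab]
  ext y
  have hy : y + y = c ↔ y - x ∈ {t : ℂ ⧸ Λ | t + t = 0} := by
    rw [Set.mem_ofPred_eq, sub_add_sub_comm, hx, sub_eq_zero]
  rw [Set.mem_ofPred_eq, hy, ← hT]
  simp [sub_eq_iff_eq_add']


/-- Example 2: the fixed point set `F` of `τ₂ ∘ τ₃` on the product of two complex tori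
has exactly 16 elements, the group `G` generated by `τ₁`, `τ₂`, `τ₃` maps `F` to itself,
and the action of `G` on `F` has exactly 4 orbits. -/
theorem stmt_10 (Λ₁ Λ₂ : AddSubgroup ℂ)
    (hdisc₁ : DiscreteTopology Λ₁) (hspan₁ : Submodule.span ℝ (Λ₁ : Set ℂ) = ⊤)
    (hdisc₂ : DiscreteTopology Λ₂) (hspan₂ : Submodule.span ℝ (Λ₂ : Set ℂ) = ⊤)
    (a₁ a₂ : ℂ ⧸ Λ₁) (b₁ b₃ : ℂ ⧸ Λ₂)
    (ha₁2 : a₁ + a₁ = 0) (ha₂2 : a₂ + a₂ = 0)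
    (ha₁ : a₁ ≠ 0) (ha₂ : a₂ ≠ 0) (ha₁₂ : a₁ + a₂ ≠ 0)
    (hb₁2 : b₁ + b₁ = 0) (hb₃2 : b₃ + b₃ = 0)
    (hb₁ : b₁ ≠ 0) (hb₃ : b₃ ≠ 0) (hb₁₃ : b₁ + b₃ ≠ 0)
    (τ₁ τ₂ τ₃ : Equiv.Perm ((ℂ ⧸ Λ₁) × (ℂ ⧸ Λ₂)))
    (hτ₁ : ∀ p, τ₁ p = (p.1 + a₁, p.2 + b₁))
    (hτ₂ : ∀ p, τ₂ p = (p.1 + a₂, -p.2))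
    (hτ₃ : ∀ p, τ₃ p = (-p.1, p.2 + b₃))
    (F : Set ((ℂ ⧸ Λ₁) × (ℂ ⧸ Λ₂))) (hF : F = {p | τ₂ (τ₃ p) = p})
    (G : Subgroup (Equiv.Perm ((ℂ ⧸ Λ₁) × (ℂ ⧸ Λ₂))))
    (hG : G = Subgroup.closure {τ₁, τ₂, τ₃}) :
    F.Finite ∧ F.ncard = 16 ∧
    (∀ g ∈ G, ∀ p ∈ F, g p ∈ F) ∧
    {S : Set ((ℂ ⧸ Λ₁) × (ℂ ⧸ Λ₂)) | ∃ p ∈ F, S = MulAction.orbit G p}.ncard = 4 := by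
  have hmem : ∀ p, p ∈ F ↔ p.1 + p.1 = a₂ ∧ p.2 + p.2 = b₃ := by
    intro p
    have e₁ : -p.1 + a₂ = p.1 ↔ p.1 + p.1 = a₂ := by
      rw [neg_add_eq_iff_eq_add, eq_comm]
    have e₂ : -(p.2 + b₃) = p.2 ↔ p.2 + p.2 = b₃ := by
      rw [neg_eq_iff_add_eq_zero, add_right_comm, add_eq_zero_iff_eq_neg,
        neg_eq_of_add_eq_zero_left hb₃2]
    rw [hF, Set.mem_ofPred_eq, hτ₃, hτ₂, Prod.ext_iff, e₁, e₂]
  obtain ⟨x₀, hx₀⟩ := exists_add_self_eq_quotient Λ₁ a₂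
  obtain ⟨y₀, hy₀⟩ := exists_add_self_eq_quotient Λ₂ b₃
  have hX := setOf_add_self_eq Λ₁ hdisc₁ hspan₁ ha₁2 ha₂2 ha₁ ha₂ ha₁₂ hx₀
  have hY := setOf_add_self_eq Λ₂ hdisc₂ hspan₂ hb₁2 hb₃2 hb₁ hb₃ hb₁₃ hy₀
  have hXcard : {x | x + x = a₂}.ncard = 4 := by
    rw [hX, ncard_span_two_torsion x₀ ha₂2 ha₁ ha₂ ha₁₂]
  have hYcard : {y | y + y = b₃}.ncard = 4 := by
    rw [hY, ncard_span_two_torsion y₀ hb₃2 hb₁ hb₃ hb₁₃]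
  have hprod : F = {x | x + x = a₂} ×ˢ {y | y + y = b₃} := by
    ext p
    exact hmem p
  have hcard : F.ncard = 16 := by
    rw [hprod, Set.ncard_prod, hXcard, hYcard]
  let H : AddSubgroup ((ℂ ⧸ Λ₁) × (ℂ ⧸ Λ₂)) := AddSubgroup.closure {(a₁, b₁), (a₂, b₃)}
  have h₁H : (a₁, b₁) ∈ H := AddSubgroup.subset_closure (by simp)
  have h₂H : (a₂, b₃) ∈ H := AddSubgroup.subset_closure (by simp)
  have hG' : ∀ g ∈ G, ∀ p, (g p ∈ F ↔ p ∈ F) ∧ (p ∈ F → g p - p ∈ H) := by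
    intro g hg
    rw [hG] at hg
    induction hg using Subgroup.closure_induction with
    | mem g hg =>
      rintro ⟨x, y⟩
      rcases hg with rfl | rfl | rfl
      · rw [hmem, hmem, hτ₁]
        refine ⟨by rw [add_add_self_of_two_torsion ha₁2, add_add_self_of_two_torsion hb₁2],
          fun _ => ?_⟩
        convert h₁H using 1
        ext <;> simp
      · rw [hmem, hmem, hτ₂]
        refine ⟨?_, fun h => ?_⟩
        · simp only [add_add_self_of_two_torsion ha₂2, ← neg_add, neg_eq_iff_eq_neg,
            neg_eq_of_add_eq_zero_left hb₃2]
        · convert h₂H using 1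
          ext
          · simp
          · have h2 : y + y = b₃ := h.2
            rw [← neg_eq_of_add_eq_zero_left hb₃2, ← h2]
            simp only [Prod.snd_sub]
            abel
      · rw [hmem, hmem, hτ₃]
        refine ⟨?_, fun h => ?_⟩
        · simp only [add_add_self_of_two_torsion hb₃2, ← neg_add, neg_eq_iff_eq_neg,
            neg_eq_of_add_eq_zero_left ha₂2]
        · convert h₂H using 1
          ext
          · have h1 : x + x = a₂ := h.1
            rw [← neg_eq_of_add_eq_zero_left ha₂2, ← h1]
            simp only [Prod.fst_sub]
            abel
          · simp
    | one => simp [H.zero_mem]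
    | mul g h _ _ ihg ihh =>
      intro p
      refine ⟨(ihg (h p)).1.trans (ihh p).1, fun hp => ?_⟩
      have := H.add_mem ((ihg (h p)).2 ((ihh p).1.2 hp)) ((ihh p).2 hp)
      rwa [sub_add_sub_cancel] at this
    | inv g _ ih =>
      intro p
      have h := ih (g⁻¹ p)
      rw [← Equiv.Perm.mul_apply, mul_inv_cancel, Equiv.Perm.one_apply] at h
      refine ⟨h.1.symm, fun hp => ?_⟩
      have := H.neg_mem (h.2 (h.1.1 hp))
      rwa [neg_sub] at this
  have hτ₁G : τ₁ ∈ G := hG ▸ Subgroup.subset_closure (by simp)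
  have hτ₂G : τ₂ ∈ G := hG ▸ Subgroup.subset_closure (by simp)
  have hinj : Set.InjOn (fun y => MulAction.orbit G (x₀, y)) {y | y + y = b₃} := by
    intro y hy y' _ h
    have hmemo : (x₀, y') ∈ MulAction.orbit G (x₀, y) := by
      change MulAction.orbit G (x₀, y) = MulAction.orbit G (x₀, y') at h
      rw [h]
      exact MulAction.mem_orbit_self _
    obtain ⟨g, hg⟩ := hmemo
    have hd := (hG' g g.2 (x₀, y)).2 ((hmem _).2 ⟨hx₀, hy⟩)
    have hg' : (g : Equiv.Perm _) (x₀, y) = (x₀, y') := hg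
    rw [hg', AddSubgroup.mem_closure_pair] at hd
    obtain ⟨m, n, hmn⟩ := hd
    rw [Prod.ext_iff] at hmn
    have h1 : m • a₁ + n • a₂ = 0 := by simpa using hmn.1
    have h2 : m • b₁ + n • b₃ = y' - y := by simpa using hmn.2
    obtain ⟨hm, hn⟩ := even_of_zsmul_add_zsmul_eq_zero ha₁2 ha₂2 ha₁ ha₂ ha₁₂ h1
    rw [even_zsmul_eq_zero hb₁2 hm, even_zsmul_eq_zero hb₃2 hn, add_zero, eq_comm,
      sub_eq_zero] at h2
    exact h2.symm
  have horb : {S : Set ((ℂ ⧸ Λ₁) × (ℂ ⧸ Λ₂)) | ∃ p ∈ F, S = MulAction.orbit G p} =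
      (fun y => MulAction.orbit G (x₀, y)) '' {y | y + y = b₃} := by
    ext S
    constructor
    · rintro ⟨⟨x, y⟩, hp, rfl⟩
      have key : ∃ g ∈ G, (g (x, y)).1 = x₀ := by
        have hx : x ∈ {x | x + x = a₂} := ((hmem _).1 hp).1
        rw [hX] at hx
        rcases hx with rfl | rfl | rfl | rfl
        · exact ⟨1, G.one_mem, rfl⟩
        · exact ⟨τ₁, hτ₁G, by simp [hτ₁, add_assoc, ha₁2]⟩
        · exact ⟨τ₂, hτ₂G, by simp [hτ₂, add_assoc, ha₂2]⟩
        · refine ⟨τ₁ * τ₂, G.mul_mem hτ₁G hτ₂G, ?_⟩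
          rw [Equiv.Perm.mul_apply, hτ₂, hτ₁]
          calc x₀ + (a₁ + a₂) + a₂ + a₁ = x₀ + (a₁ + a₁) + (a₂ + a₂) := by abel
            _ = x₀ := by rw [ha₁2, ha₂2, add_zero, add_zero]
      obtain ⟨g, hg, hgx⟩ := key
      have hgF := ((hmem _).1 ((hG' g hg (x, y)).1.2 hp)).2
      refine ⟨(g (x, y)).2, hgF, ?_⟩
      have he : (x₀, (g (x, y)).2) = (⟨g, hg⟩ : G) • (x, y) := Prod.ext hgx.symm rfl
      change MulAction.orbit G (x₀, (g (x, y)).2) = _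
      rw [he, MulAction.orbit_smul]
    · rintro ⟨y, hy, rfl⟩
      exact ⟨(x₀, y), (hmem _).2 ⟨hx₀, hy⟩, rfl⟩
  refine ⟨Set.finite_of_ncard_ne_zero (by rw [hcard]; norm_num), hcard,
    fun g hg p hp => (hG' g hg p).1.2 hp, ?_⟩
  rw [horb, hinj.ncard_image, hYcard]
end

section
/- Let M be a ℤ-module with a symmetric ℤ-bilinear form B such that B(x,x) is even for every x ∈ M (an even lattice). Let v₁, …, v_k ∈ M satisfy B(vᵢ,vᵢ) = −2 for all i and B(vᵢ,vⱼ) = 0 for all i ≠ j. If I ⊆ {1,…,k} is a subset and w ∈ M is such that Σ_{i∈I} vᵢ = 2w, then the cardinality of I equals −2·B(w,w); in particular, the cardinality of I is divisible by 4. -/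
/-- In an even lattice, if `v₁, …, v_k` are pairwise orthogonal vectors of square `-2`
and `Σ_{i ∈ I} vᵢ = 2w`, then `|I| = -2·B(w,w)`; in particular `4 ∣ |I|`. -/
theorem stmt_11 {M : Type*} [AddCommGroup M] [Module ℤ M]
    (B : M →ₗ[ℤ] M →ₗ[ℤ] ℤ)
    (hsymm : ∀ x y : M, B x y = B y x)
    (heven : ∀ x : M, Even (B x x))
    (k : ℕ) (v : Fin k → M)
    (hvv : ∀ i, B (v i) (v i) = -2)
    (horth : ∀ i j, i ≠ j → B (v i) (v j) = 0)
    (I : Finset (Fin k)) (w : M) (h : ∑ i ∈ I, v i = 2 • w) :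
    (I.card : ℤ) = -2 * B w w ∧ 4 ∣ I.card := by
  have hsum : B (∑ i ∈ I, v i) (∑ i ∈ I, v i) = -2 * (I.card : ℤ) := by
    have hrow : ∀ i ∈ I, ∑ j ∈ I, B (v j) (v i) = -2 := fun i hi => by
      rw [Finset.sum_eq_single_of_mem i hi fun j _ hji => horth j i hji, hvv]
    simp only [map_sum, LinearMap.sum_apply]
    rw [Finset.sum_congr rfl hrow, Finset.sum_const, nsmul_eq_mul, mul_comm]
  have hw : B (2 • w) (2 • w) = 4 * B w w := by
    simp only [two_nsmul, map_add, LinearMap.add_apply]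
    ring
  rw [h, hw] at hsum
  obtain ⟨r, hr⟩ := heven w
  omega
end
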